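/- For every integer n ≥ 2, the space of sl_2-invariant 2-coboundaries of the Heisenberg ideal h_n with values in the adjoint module sch_n, namely the space of bilinear maps of the form (a,b) ↦ [ω(a),b]+[a,ω(b)]-ω([a,b]) restricted to h_n for sl_2-invariant linear maps ω: h_n → sch_n, has dimension n(n+1)/2. -/

import Mathlib

open scoped BigOperators

/-- Basis index set for the `n`-th Schrödinger algebra
`sch_n = span {h, e, f, x_1, …, x_n, y_1, …, y_n, z}`. -/
inductive SchIdx (n : ℕ) : Type
  | H : SchIdx n
  | E : SchIdx n
  | F : SchIdx n
  | X : Fin n → SchIdx n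
  | Y : Fin n → SchIdx n
  | Z : SchIdx n
  deriving DecidableEq

/-- The underlying vector space of the `n`-th Schrödinger algebra. -/
abbrev Sch (n : ℕ) : Type := SchIdx n → ℂ

/-- The Lie bracket of `sch_n`, written componentwise with respect to the basis;
it encodes exactly the relations `[e,f]=h, [h,e]=2e, [h,f]=-2f, [x_i,y_i]=z,
[h,x_i]=x_i, [h,y_i]=-y_i, [e,y_i]=x_i, [f,x_i]=y_i`. -/
noncomputable def br {n : ℕ} (u v : Sch n) : Sch n := fun j =>
  match j with
  | .H => u .E * v .F - u .F * v .E
  | .E => 2 * (u .H * v .E - u .E * v .H)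
  | .F => -2 * (u .H * v .F - u .F * v .H)
  | .X i => (u .H * v (.X i) - u (.X i) * v .H) + (u .E * v (.Y i) - u (.Y i) * v .E)
  | .Y i => -(u .H * v (.Y i) - u (.Y i) * v .H) + (u .F * v (.X i) - u (.X i) * v .F)
  | .Z => ∑ i : Fin n, (u (.X i) * v (.Y i) - u (.Y i) * v (.X i))

/-- The bracket of `sch_n` as a bilinear map. -/
noncomputable def brL (n : ℕ) : Sch n →ₗ[ℂ] Sch n →ₗ[ℂ] Sch n :=
  LinearMap.mk₂ ℂ br
    (by
      intro m m' v; funext j; cases j <;> simp only [br, Pi.add_apply]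
      case Z => rw [← Finset.sum_add_distrib]; exact Finset.sum_congr rfl fun i _ => by ring
      all_goals ring)
    (by
      intro c m v; funext j; cases j <;> simp only [br, Pi.smul_apply, smul_eq_mul]
      case Z => rw [Finset.mul_sum]; exact Finset.sum_congr rfl fun i _ => by ring
      all_goals ring)
    (by
      intro m v v'; funext j; cases j <;> simp only [br, Pi.add_apply]
      case Z => rw [← Finset.sum_add_distrib]; exact Finset.sum_congr rfl fun i _ => by ring
      all_goals ring)
    (by
      intro c m v; funext j; cases j <;> simp only [br, Pi.smul_apply, smul_eq_mul]
      case Z => rw [Finset.mul_sum]; exact Finset.sum_congr rfl fun i _ => by ring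
      all_goals ring)

/-- The basis vector `h`. -/
noncomputable def hV (n : ℕ) : Sch n := Pi.single SchIdx.H 1
/-- The basis vector `e`. -/
noncomputable def eV (n : ℕ) : Sch n := Pi.single SchIdx.E 1
/-- The basis vector `f`. -/
noncomputable def fV (n : ℕ) : Sch n := Pi.single SchIdx.F 1
/-- The central basis vector `z`. -/
noncomputable def zV (n : ℕ) : Sch n := Pi.single SchIdx.Z 1
/-- The basis vector `x_i`. -/
noncomputable def xV {n : ℕ} (i : Fin n) : Sch n := Pi.single (SchIdx.X i) 1
/-- The basis vector `y_i`. -/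
noncomputable def yV {n : ℕ} (i : Fin n) : Sch n := Pi.single (SchIdx.Y i) 1

/-- The subalgebra `sl_2 = span {e, f, h}` of `sch_n`. -/
noncomputable def sl2 (n : ℕ) : Submodule ℂ (Sch n) :=
  Submodule.span ℂ {eV n, fV n, hV n}
/-- Basis index set for the Heisenberg ideal `h_n = span {x_1, …, x_n, y_1, …, y_n, z}`. -/
inductive HIdx (n : ℕ) : Type
  | X : Fin n → HIdx n
  | Y : Fin n → HIdx n
  | Z : HIdx n
  deriving DecidableEq

/-- The underlying vector space of the Heisenberg ideal `h_n` of `sch_n`. -/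
abbrev Heis (n : ℕ) : Type := HIdx n → ℂ

/-- The natural inclusion `h_n → sch_n`. -/
noncomputable def ιH {n : ℕ} (a : Heis n) : Sch n := fun j =>
  match j with
  | .X i => a (.X i)
  | .Y i => a (.Y i)
  | .Z => a .Z
  | .H => 0
  | .E => 0
  | .F => 0

/-- The action of `v ∈ sch_n` on the ideal `h_n`: `act v a = [v, a]`, viewed inside `h_n`
(the ideal `h_n` is stable under taking brackets with any element). -/
noncomputable def act {n : ℕ} (v : Sch n) (a : Heis n) : Heis n := fun j =>
  match j with
  | .X i => brL n v (ιH a) (SchIdx.X i)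
  | .Y i => brL n v (ιH a) (SchIdx.Y i)
  | .Z => brL n v (ιH a) SchIdx.Z

/-- The bracket of the Heisenberg algebra `h_n`. -/
noncomputable def brH {n : ℕ} (a b : Heis n) : Heis n := act (ιH a) b

/-- The basis vector `x_i` of `h_n`. -/
noncomputable def xH {n : ℕ} (i : Fin n) : Heis n := Pi.single (HIdx.X i) 1
/-- The basis vector `y_i` of `h_n`. -/
noncomputable def yH {n : ℕ} (i : Fin n) : Heis n := Pi.single (HIdx.Y i) 1
/-- The basis vector `z` of `h_n`. -/
noncomputable def zH (n : ℕ) : Heis n := Pi.single HIdx.Z 1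
/-- The space of `sl_2`-invariant linear maps `ω : h_n → sch_n`, i.e. those with
`[v, ω(a)] = ω([v,a])` for all `v ∈ sl_2` and `a ∈ h_n`. -/
noncomputable def invHom (n : ℕ) : Submodule ℂ (Heis n →ₗ[ℂ] Sch n) where
  carrier := {ω | ∀ v ∈ sl2 n, ∀ a, brL n v (ω a) = ω (act v a)}
  add_mem' := by
    rintro ω σ hω hσ v hv a
    simp only [LinearMap.add_apply, map_add, hω v hv a, hσ v hv a]
  zero_mem' := by intro v hv a; simp
  smul_mem' := by
    rintro c ω hω v hv a
    simp only [LinearMap.smul_apply, map_smul, hω v hv a]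
noncomputable instance (n : ℕ) : AddCommGroup (Heis n →ₗ[ℂ] Heis n →ₗ[ℂ] Sch n) :=
  LinearMap.addCommGroup

noncomputable instance (n : ℕ) : Module ℂ (Heis n →ₗ[ℂ] Heis n →ₗ[ℂ] Sch n) :=
  LinearMap.module

/-- The space of `sl_2`-invariant 2-coboundaries of `h_n` with values in the adjoint
module `sch_n`: bilinear maps of the form `(a,b) ↦ [ω(a),b] + [a,ω(b)] - ω([a,b])`
for an `sl_2`-invariant linear map `ω : h_n → sch_n`. -/
noncomputable def adjInvB2Heis (n : ℕ) : Submodule ℂ (Heis n →ₗ[ℂ] Heis n →ₗ[ℂ] Sch n) where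
  carrier := {φ | ∃ ω ∈ invHom n, ∀ a b,
    φ a b = brL n (ω a) (ιH b) + brL n (ιH a) (ω b) - ω (brH a b)}
  add_mem' := by
    rintro φ ψ ⟨ω, hωm, hω⟩ ⟨σ, hσm, hσ⟩
    refine ⟨ω + σ, Submodule.add_mem _ hωm hσm, fun a b => ?_⟩
    simp only [LinearMap.add_apply, map_add, hω a b, hσ a b]
    abel
  zero_mem' := ⟨0, Submodule.zero_mem _, fun a b => by simp⟩
  smul_mem' := by
    rintro c φ ⟨ω, hωm, hω⟩
    refine ⟨c • ω, Submodule.smul_mem _ c hωm, fun a b => ?_⟩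
    simp only [LinearMap.smul_apply, map_smul, hω a b, smul_add, smul_sub]

/-- The alternating `ℂ z`-valued form `(a, b) ↦ ∑ i j, s_{ij} (a_{x_i} b_{y_j} - a_{y_i} b_{x_j}) z`
attached to a symmetric matrix `s`. -/
noncomputable def symForm (n : ℕ) :
    (Sym2 (Fin n) → ℂ) →ₗ[ℂ] Heis n →ₗ[ℂ] Heis n →ₗ[ℂ] Sch n where
  toFun s := LinearMap.mk₂ ℂ
    (fun a b => (∑ i, ∑ j, s s(i, j) * (a (.X i) * b (.Y j) - a (.Y i) * b (.X j))) • zV n)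
    (by
      intro a a' b
      rw [← add_smul]
      simp only [← Finset.sum_add_distrib, Pi.add_apply]
      congr! 3; ring)
    (by
      intro c a b
      simp only [smul_smul, Finset.mul_sum, Pi.smul_apply, smul_eq_mul]
      congr! 3; ring)
    (by
      intro a b b'
      rw [← add_smul]
      simp only [← Finset.sum_add_distrib, Pi.add_apply]
      congr! 3; ring)
    (by
      intro c a b
      simp only [smul_smul, Finset.mul_sum, Pi.smul_apply, smul_eq_mul]
      congr! 3; ring)
  map_add' s t := by
    refine LinearMap.ext₂ fun a b => ?_
    simp only [LinearMap.add_apply, LinearMap.mk₂_apply, Pi.add_apply, add_mul,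
      Finset.sum_add_distrib, add_smul]
  map_smul' c s := by
    refine LinearMap.ext₂ fun a b => ?_
    simp only [LinearMap.smul_apply, LinearMap.mk₂_apply, Pi.smul_apply, smul_eq_mul, mul_assoc,
      ← Finset.mul_sum, smul_smul, RingHom.id_apply]

theorem symForm_apply {n : ℕ} (s : Sym2 (Fin n) → ℂ) (a b : Heis n) :
    symForm n s a b =
      (∑ i, ∑ j, s s(i, j) * (a (.X i) * b (.Y j) - a (.Y i) * b (.X j))) • zV n := rfl

theorem symForm_injective (n : ℕ) : Function.Injective (symForm n) := by
  intro s t h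
  funext p
  induction p with
  | _ i j =>
    have h' := congrFun (LinearMap.congr_fun₂ h (xH i) (yH j)) .Z
    simpa [symForm_apply, xH, yH, zV, Pi.single_apply] using h'

theorem brL_apply {n : ℕ} (u v : Sch n) : brL n u v = br u v := rfl

/-- The map `h_n → sch_n` acting by the matrix `A` on the `x_i` and on the `y_i`,
and by the scalar `c` on `z`. -/
noncomputable def diagHom {n : ℕ} (A : Fin n → Fin n → ℂ) (c : ℂ) : Heis n →ₗ[ℂ] Sch n where
  toFun a
    | .X i => ∑ j, A i j * a (.X j)
    | .Y i => ∑ j, A i j * a (.Y j)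
    | .Z => c * a .Z
    | .H => 0
    | .E => 0
    | .F => 0
  map_add' a b := by
    funext k; cases k <;> simp [mul_add, Finset.sum_add_distrib]
  map_smul' r a := by
    funext k; cases k <;> simp [Finset.mul_sum, mul_left_comm]

instance (n : ℕ) : Finite (HIdx n) :=
  Finite.of_surjective
    (Sum.elim HIdx.X (Sum.elim HIdx.Y fun _ => HIdx.Z) : Fin n ⊕ Fin n ⊕ Unit → HIdx n) fun
    | .X i => ⟨.inl i, rfl⟩
    | .Y i => ⟨.inr (.inl i), rfl⟩
    | .Z => ⟨.inr (.inr ()), rfl⟩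

theorem heis_hom_ext {n : ℕ} {ω σ : Heis n →ₗ[ℂ] Sch n} (hx : ∀ i, ω (xH i) = σ (xH i))
    (hy : ∀ i, ω (yH i) = σ (yH i)) (hz : ω (zH n) = σ (zH n)) : ω = σ := by
  refine LinearMap.pi_ext' fun k => LinearMap.ext_ring ?_
  cases k
  exacts [hx _, hy _, hz]

theorem apply_eq_zero_of_mem_sl2 {n : ℕ} {v : Sch n} (hv : v ∈ sl2 n) :
    (∀ i, v (.X i) = 0) ∧ (∀ i, v (.Y i) = 0) := by
  induction hv using Submodule.span_induction with
  | mem v hv => rcases hv with rfl | rfl | rfl <;> simp [eV, fV, hV]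
  | zero => simp
  | add u v _ _ hu hv => simp [hu, hv]
  | smul c v _ hv => simp [hv]

theorem diagHom_mem_invHom {n : ℕ} (A : Fin n → Fin n → ℂ) (c : ℂ) :
    diagHom A c ∈ invHom n := by
  intro v hv a
  obtain ⟨hX, hY⟩ := apply_eq_zero_of_mem_sl2 hv
  funext k
  cases k <;>
    simp [diagHom, brL_apply, br, act, ιH, hX, hY, mul_add, Finset.sum_add_distrib,
      Finset.mul_sum, mul_left_comm]

theorem eq_diagHom_of_mem_invHom {n : ℕ} {ω : Heis n →ₗ[ℂ] Sch n} (hω : ω ∈ invHom n) :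
    ω = diagHom (fun i j => ω (xH j) (.X i)) (ω (zH n) .Z) := by
  have he : eV n ∈ sl2 n := Submodule.subset_span (by simp)
  have hf : fV n ∈ sl2 n := Submodule.subset_span (by simp)
  have hh : hV n ∈ sl2 n := Submodule.subset_span (by simp)
  have hhx (i : Fin n) : act (hV n) (xH i) = xH i := by
    funext k; cases k <;> simp [act, brL_apply, br, hV, xH, ιH, Pi.single_apply]
  have hfx (i : Fin n) : act (fV n) (xH i) = yH i := by
    funext k; cases k <;> simp [act, brL_apply, br, fV, xH, yH, ιH, Pi.single_apply]
  have hhz : act (hV n) (zH n) = 0 := by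
    funext k; cases k <;> simp [act, brL_apply, br, hV, zH, ιH]
  have hez : act (eV n) (zH n) = 0 := by
    funext k; cases k <;> simp [act, brL_apply, br, eV, zH, ιH]
  have hx (i : Fin n) (k) := congrFun (hω _ hh (xH i)) k
  have hy (i : Fin n) (k) := congrFun (hω _ hf (xH i)) k
  have hz (k) := congrFun (hω _ hh (zH n)) k
  have hz' := congrFun (hω _ he (zH n)) .E
  simp only [hhx, hfx, hhz, hez, map_zero, brL_apply] at hx hy hz hz'
  have hxH (i : Fin n) : ω (xH i) .H = 0 := by simpa [br, hV, eq_comm] using hx i .H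
  have hxE (i : Fin n) : ω (xH i) .E = 0 := by
    have := hx i .E
    simp [br, hV] at this
    linear_combination this
  refine heis_hom_ext (fun i => ?_) (fun i => ?_) ?_
  · funext k
    have h := hx i k
    cases k <;> simp [br, hV] at h <;> simp [diagHom, xH, Pi.single_apply] <;>
      simp only [xH] at h
    · exact h.symm
    · linear_combination h
    · linear_combination (-1 / 3) * h
    · linear_combination (-1 / 2) * h
    · exact h.symm
  · funext k
    have h := hy i k
    cases k <;> simp [br, fV, hxH, hxE] at h <;>
      simp [diagHom, yH, Pi.single_apply] <;> simp only [yH] at h <;> exact h.symm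
  · funext k
    have h := hz k
    cases k
    case H => simpa [br, eV, diagHom] using hz'
    case Z => simp [diagHom, zH]
    all_goals simpa [br, hV, diagHom, zH] using h

theorem coboundary_diagHom {n : ℕ} (A : Fin n → Fin n → ℂ) (c : ℂ) {s : Sym2 (Fin n) → ℂ}
    (hs : ∀ i j, s s(i, j) = A i j + A j i - if i = j then c else 0) (a b : Heis n) :
    brL n (diagHom A c a) (ιH b) + brL n (ιH a) (diagHom A c b) - diagHom A c (brH a b) =
      symForm n s a b := by
  funext k
  cases k
  case Z =>
    have hcomm (u v : Fin n → ℂ) :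
        ∑ i, ∑ j, A j i * (u i * v j) = ∑ i, (∑ j, A i j * u j) * v i := by
      rw [Finset.sum_comm]
      simp only [Finset.sum_mul, mul_assoc]
    have hassoc (u v : Fin n → ℂ) :
        ∑ i, ∑ j, A i j * (u i * v j) = ∑ i, u i * ∑ j, A i j * v j := by
      simp only [Finset.mul_sum, mul_left_comm]
    simp only [symForm_apply, hs, sub_mul, add_mul, mul_sub, Finset.sum_add_distrib,
      Finset.sum_sub_distrib, hcomm, hassoc]
    simp [diagHom, brL_apply, br, brH, act, ιH, zV, Finset.mul_sum, Finset.sum_sub_distrib,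
      mul_sub]
    ring
  all_goals simp [diagHom, brL_apply, br, brH, act, ιH, symForm_apply, zV]

theorem range_symForm (n : ℕ) : LinearMap.range (symForm n) = adjInvB2Heis n := by
  ext φ
  constructor
  · rintro ⟨s, rfl⟩
    refine ⟨diagHom (fun i j => s s(i, j) / 2) 0, diagHom_mem_invHom _ _, fun a b => ?_⟩
    refine (coboundary_diagHom _ _ (fun i j => ?_) a b).symm
    rw [Sym2.eq_swap (a := j)]
    simp
  · rintro ⟨ω, hω, h⟩
    rw [eq_diagHom_of_mem_invHom hω] at h
    set A : Fin n → Fin n → ℂ := fun i j => ω (xH j) (.X i)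
    set c := ω (zH n) .Z
    let s : Sym2 (Fin n) → ℂ := Sym2.lift
      ⟨fun i j => A i j + A j i - if i = j then c else 0,
        fun i j => by simp only [add_comm, eq_comm]⟩
    refine ⟨s, LinearMap.ext₂ fun a b => ?_⟩
    rw [h, coboundary_diagHom A c (s := s) fun i j => rfl]

/-- **For every `n ≥ 2`, the space of `sl_2`-invariant 2-coboundaries of the Heisenberg
ideal `h_n` with values in the adjoint module `sch_n` has dimension `n(n+1)/2`.** -/
theorem dim_adjInvB2Heis (n : ℕ) (hn : 2 ≤ n) :
    Module.finrank ℂ ↥(adjInvB2Heis n) = n * (n + 1) / 2 := by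
  rw [← range_symForm, LinearMap.finrank_range_of_inj (symForm_injective n),
    Module.finrank_fintype_fun_eq_card, Sym2.card, Fintype.card_fin, Nat.choose_two_right,
    Nat.add_sub_cancel, mul_comm]
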